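/- arXiv:math/0611003 — 3 statements merged into one kernel-verified Lean document; each statement's English description precedes it below -/
import Mathlib

section
/- If r satisfies the classical Yang–Baxter equation, then the trigonometric r-matrix 𝐫 satisfies the classical Yang–Baxter equation with spectral parameter: for all z₁, z₂, z₃ ∈ ℂ with e^{z_i − z_j} ≠ 1 for all i ≠ j, one has [𝐫₁₂(z₁−z₂), 𝐫₁₃(z₁−z₃)] + [𝐫₁₂(z₁−z₂), 𝐫₂₃(z₂−z₃)] + [𝐫₁₃(z₁−z₃), 𝐫₂₃(z₂−z₃)] = 0 in A⊗A⊗A. -/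
/-!
STATEMENT 1: If `r` satisfies the classical Yang–Baxter equation, then the trigonometric
r-matrix `𝐫(u) = (e^u·r₂₁ + r)/(e^u − 1)` satisfies the classical Yang–Baxter equation with
spectral parameter:
`[𝐫₁₂(z₁−z₂), 𝐫₁₃(z₁−z₃)] + [𝐫₁₂(z₁−z₂), 𝐫₂₃(z₂−z₃)] + [𝐫₁₃(z₁−z₃), 𝐫₂₃(z₂−z₃)] = 0`
in `A ⊗ A ⊗ A`, whenever `e^{z_i − z_j} ≠ 1` for all `i ≠ j`.
-/

open scoped TensorProduct
open PiTensorProduct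

noncomputable section

variable {A : Type*} [Ring A] [Algebra ℂ A]

/-- The flip `x ↦ x₂₁` on `A ⊗ A`. -/
def flip2 (x : A ⊗[ℂ] A) : A ⊗[ℂ] A := TensorProduct.comm ℂ A A x

/-- The trigonometric r-matrix `𝐫(u) = (e^u · r₂₁ + r)/(e^u − 1)`. -/
def trigR (r : A ⊗[ℂ] A) (u : ℂ) : A ⊗[ℂ] A :=
  (Complex.exp u - 1)⁻¹ • (Complex.exp u • flip2 r + r)

/-- `a^{(j)} = 1 ⊗ ⋯ ⊗ a ⊗ ⋯ ⊗ 1 ∈ A^{⊗n}`, with `a` in the `j`-th factor. -/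
def single (n : ℕ) (j : Fin n) (a : A) : ⨂[ℂ] _ : Fin n, A :=
  tprod ℂ (Function.update (fun _ => (1 : A)) j a)

lemma single_add (n : ℕ) (j : Fin n) (a b : A) :
    single n j (a + b) = single n j a + single n j b := by
  simp [single]

lemma single_smul (n : ℕ) (j : Fin n) (c : ℂ) (a : A) :
    single n j (c • a) = c • single n j a := by
  simp [single]

/-- `leg2 n j k` sends `x = Σ aᵢ ⊗ bᵢ ∈ A ⊗ A` to `x_{jk} = Σ aᵢ^{(j)} · bᵢ^{(k)} ∈ A^{⊗n}`,
i.e. the image of `x` with its first leg in tensor factor `j` and second leg in factor `k`. -/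
def leg2 (n : ℕ) (j k : Fin n) : (A ⊗[ℂ] A) →ₗ[ℂ] ⨂[ℂ] _ : Fin n, A :=
  TensorProduct.lift <| LinearMap.mk₂ ℂ (fun a b => single n j a * single n k b)
    (fun a a' b => by rw [single_add, add_mul])
    (fun c a b => by rw [single_smul, smul_mul_assoc])
    (fun a b b' => by rw [single_add, mul_add])
    (fun c a b => by rw [single_smul, mul_smul_comm])

/-- The classical Yang–Baxter equation `[r₁₂,r₁₃] + [r₁₂,r₂₃] + [r₁₃,r₂₃] = 0` in `A^{⊗3}`. -/
def CYBE (r : A ⊗[ℂ] A) : Prop :=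
  (leg2 3 0 1 r * leg2 3 0 2 r - leg2 3 0 2 r * leg2 3 0 1 r) +
  (leg2 3 0 1 r * leg2 3 1 2 r - leg2 3 1 2 r * leg2 3 0 1 r) +
  (leg2 3 0 2 r * leg2 3 1 2 r - leg2 3 1 2 r * leg2 3 0 2 r) = 0

/-- The algebra endomorphism of `A^{⊗n}` permuting the tensor factors. -/
def permHom (n : ℕ) (e : Equiv.Perm (Fin n)) :
    (⨂[ℂ] _ : Fin n, A) →ₐ[ℂ] (⨂[ℂ] _ : Fin n, A) :=
  PiTensorProduct.liftAlgHom
    ((tprod ℂ : MultilinearMap ℂ (fun _ : Fin n => A) _).domDomCongr e)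
    (by rfl)
    (fun x y => by
      simp only [MultilinearMap.domDomCongr_apply, tprod_mul_tprod]
      rfl)

lemma permHom_single (n : ℕ) (e : Equiv.Perm (Fin n)) (j : Fin n) (a : A) :
    permHom n e (single n j a) = single n (e.symm j) a := by
  have h : permHom n e (single n j a) =
      tprod ℂ (fun i => Function.update (fun _ => (1 : A)) j a (e i)) := by
    unfold permHom single
    exact PiTensorProduct.lift.tprod _
  rw [h, single]
  congr 1
  funext i
  simp only [Function.update_apply, Equiv.eq_symm_apply]

lemma permHom_leg2 (n : ℕ) (e : Equiv.Perm (Fin n)) (j k : Fin n) (x : A ⊗[ℂ] A) :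
    permHom n e (leg2 n j k x) = leg2 n (e.symm j) (e.symm k) x := by
  induction x using TensorProduct.induction_on with
  | zero => simp
  | tmul a b => simp [leg2, permHom_single]
  | add x y hx hy => simp [hx, hy]

lemma single_commute (n : ℕ) (j k : Fin n) (h : j ≠ k) (a b : A) :
    single n j a * single n k b = single n k b * single n j a := by
  unfold single
  rw [tprod_mul_tprod, tprod_mul_tprod]
  congr 1
  funext i
  simp only [Pi.mul_apply, Function.update_apply]
  split_ifs with h1 h2
  · exact absurd (h1.symm.trans h2) h
  all_goals simp

lemma leg2_flip2 (n : ℕ) (j k : Fin n) (h : j ≠ k) (x : A ⊗[ℂ] A) :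
    leg2 n j k (flip2 x) = leg2 n k j x := by
  unfold flip2
  induction x using TensorProduct.induction_on with
  | zero => simp
  | tmul a b => simp [leg2, single_commute n j k h]
  | add x y hx hy => simp [hx, hy]

lemma CYBE_perm (r : A ⊗[ℂ] A) (hr : CYBE r) (e : Equiv.Perm (Fin 3)) :
    (leg2 3 (e 0) (e 1) r * leg2 3 (e 0) (e 2) r -
      leg2 3 (e 0) (e 2) r * leg2 3 (e 0) (e 1) r) +
    (leg2 3 (e 0) (e 1) r * leg2 3 (e 1) (e 2) r -
      leg2 3 (e 1) (e 2) r * leg2 3 (e 0) (e 1) r) +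
    (leg2 3 (e 0) (e 2) r * leg2 3 (e 1) (e 2) r -
      leg2 3 (e 1) (e 2) r * leg2 3 (e 0) (e 2) r) = 0 := by
  have h := congrArg (permHom 3 e.symm) hr
  simpa only [map_add, map_sub, map_mul, map_zero, permHom_leg2, Equiv.symm_symm] using h

lemma trig_combination {B : Type*} [Ring B] [Algebra ℂ B] (a aa b bb c cc : B) (x y : ℂ)
    (hx : x - 1 ≠ 0) (hy : y - 1 ≠ 0) (hxy : x * y - 1 ≠ 0)
    (E012 : (a * b - b * a) + (a * c - c * a) + (b * c - c * b) = 0)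
    (E021 : (b * a - a * b) + (b * cc - cc * b) + (a * cc - cc * a) = 0)
    (E102 : (aa * c - c * aa) + (aa * b - b * aa) + (c * b - b * c) = 0)
    (E120 : (c * aa - aa * c) + (c * bb - bb * c) + (aa * bb - bb * aa) = 0)
    (E201 : (bb * cc - cc * bb) + (bb * a - a * bb) + (cc * a - a * cc) = 0)
    (E210 : (cc * bb - bb * cc) + (cc * aa - aa * cc) + (bb * aa - aa * bb) = 0)
    (R S T : B) (hR : R = (x - 1)⁻¹ • (x • aa + a))
    (hS : S = (x * y - 1)⁻¹ • ((x * y) • bb + b))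
    (hT : T = (y - 1)⁻¹ • (y • cc + c)) :
    (R * S - S * R) + (R * T - T * R) + (S * T - T * S) = 0 := by
  subst hR hS hT
  simp only [smul_mul_assoc, mul_smul_comm, mul_add, add_mul, smul_add]
  linear_combination (norm := skip)
    ((x - 1)⁻¹ * (y - 1)⁻¹) • E012
    + ((x * y - 1)⁻¹ * (y - 1)⁻¹ * y) • E021
    + ((x - 1)⁻¹ * (x * y - 1)⁻¹ * x) • E102
    - ((x * y - 1)⁻¹ * (y - 1)⁻¹ * (x * y)) • E120
    - ((x - 1)⁻¹ * (x * y - 1)⁻¹ * (x * y)) • E201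
    - ((x - 1)⁻¹ * (y - 1)⁻¹ * (x * y)) • E210
  have hyx : y * x - 1 ≠ 0 := by rwa [mul_comm]
  match_scalars <;> field_simp <;> ring

/-- CYBE with spectral parameter for the trigonometric r-matrix. -/
theorem trigR_CYBE_spectral (r : A ⊗[ℂ] A) (hr : CYBE r)
    (z : Fin 3 → ℂ) (hz : ∀ i j : Fin 3, i ≠ j → Complex.exp (z i - z j) ≠ 1) :
    (leg2 3 0 1 (trigR r (z 0 - z 1)) * leg2 3 0 2 (trigR r (z 0 - z 2)) -
       leg2 3 0 2 (trigR r (z 0 - z 2)) * leg2 3 0 1 (trigR r (z 0 - z 1))) +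
    (leg2 3 0 1 (trigR r (z 0 - z 1)) * leg2 3 1 2 (trigR r (z 1 - z 2)) -
       leg2 3 1 2 (trigR r (z 1 - z 2)) * leg2 3 0 1 (trigR r (z 0 - z 1))) +
    (leg2 3 0 2 (trigR r (z 0 - z 2)) * leg2 3 1 2 (trigR r (z 1 - z 2)) -
       leg2 3 1 2 (trigR r (z 1 - z 2)) * leg2 3 0 2 (trigR r (z 0 - z 2))) = 0 := by
  have h01 : Complex.exp (z 0 - z 1) - 1 ≠ 0 := sub_ne_zero.mpr (hz 0 1 (by decide))
  have h12 : Complex.exp (z 1 - z 2) - 1 ≠ 0 := sub_ne_zero.mpr (hz 1 2 (by decide))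
  have h02 : Complex.exp (z 0 - z 2) - 1 ≠ 0 := sub_ne_zero.mpr (hz 0 2 (by decide))
  have hmul : Complex.exp (z 0 - z 2) =
      Complex.exp (z 0 - z 1) * Complex.exp (z 1 - z 2) := by
    rw [← Complex.exp_add]
    congr 1
    ring
  have E021 := CYBE_perm r hr (Equiv.swap 1 2)
  have E102 := CYBE_perm r hr (Equiv.swap 0 1)
  have E120 := CYBE_perm r hr (Equiv.swap 0 1 * Equiv.swap 1 2)
  have E201 := CYBE_perm r hr (Equiv.swap 1 2 * Equiv.swap 0 1)
  have E210 := CYBE_perm r hr (Equiv.swap 0 2)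
  refine trig_combination (leg2 3 0 1 r) (leg2 3 1 0 r) (leg2 3 0 2 r) (leg2 3 2 0 r)
    (leg2 3 1 2 r) (leg2 3 2 1 r) _ _ h01 h12 (hmul ▸ h02) hr E021 E102 E120 E201 E210
    _ _ _ ?_ ?_ ?_
  · rw [trigR, map_smul, map_add, map_smul, leg2_flip2 3 0 1 (by decide)]
  · rw [trigR, map_smul, map_add, map_smul, leg2_flip2 3 0 2 (by decide), hmul]
  · rw [trigR, map_smul, map_add, map_smul, leg2_flip2 3 1 2 (by decide)]

end
end

section
/- (Consistency of the trigonometric KZ equations, commutativity part.) Suppose r ∈ A⊗A satisfies the classical Yang–Baxter equation and s ∈ A satisfies [s⊗1 + 1⊗s, r] = 0. Then for every n ≥ 1, every point u = (u₁,…,u_n) ∈ ℂⁿ with e^{u_k − u_j} ≠ 1 for all k ≠ j, and all indices k ≠ j, the trigonometric KZ Hamiltonians commute: [H_k(u), H_j(u)] = 0 in A^{⊗n}. -/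
/-!
STATEMENT 4 (Consistency of the trigonometric KZ equations, commutativity part):
Suppose `r ∈ A ⊗ A` satisfies the classical Yang–Baxter equation and `s ∈ A` satisfies
`[s⊗1 + 1⊗s, r] = 0`. Then for every `n ≥ 1`, every point `u = (u₁,…,u_n) ∈ ℂⁿ` with
`e^{u_k − u_j} ≠ 1` for all `k ≠ j`, and all indices `k ≠ j`, the trigonometric KZ
Hamiltonians `H_k(u) = Σ_{j≠k} 𝐫_{kj}(u_k − u_j) + s^{(k)}` commute:
`[H_k(u), H_j(u)] = 0` in `A^{⊗n}`.
-/

open scoped TensorProduct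
open PiTensorProduct

noncomputable section

variable {A : Type*} [Ring A] [Algebra ℂ A]

/-- The trigonometric KZ Hamiltonian `H_k(u₁,…,u_n) = Σ_{j≠k} 𝐫_{kj}(u_k − u_j) + s^{(k)}`. -/
def trigKZH (n : ℕ) (r : A ⊗[ℂ] A) (s : A) (k : Fin n) (u : Fin n → ℂ) :
    ⨂[ℂ] _ : Fin n, A :=
  (∑ j ∈ Finset.univ.erase k, leg2 n k j (trigR r (u k - u j))) + single n k s

lemma aux_alg {M : Type*} [Ring M] [Algebra ℂ M] (x y z : ℂ) (a b c a' b' c' : M)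
    (hxy : x - y ≠ 0) (hxz : x - z ≠ 0) (hyz : y - z ≠ 0)
    (h123 : a*b-b*a + (a*c-c*a) + (b*c-c*b) = 0)
    (h132 : b*a-a*b + (b*c'-c'*b) + (a*c'-c'*a) = 0)
    (h213 : a'*c-c*a' + (a'*b-b*a') + (c*b-b*c) = 0)
    (h231 : c*a'-a'*c + (c*b'-b'*c) + (a'*b'-b'*a') = 0)
    (h312 : b'*c'-c'*b' + (b'*a-a*b') + (c'*a-a*c') = 0)
    (h321 : c'*b'-b'*c' + (c'*a'-a'*c') + (b'*a'-a'*b') = 0)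
    (X Y Z : M) (hX : X = (x-y)⁻¹ • (x • a' + y • a))
    (hY : Y = (x-z)⁻¹ • (x • b' + z • b)) (hZ : Z = (y-z)⁻¹ • (y • c' + z • c)) :
    X*Y-Y*X + (X*Z-Z*X) + (Y*Z-Z*Y) = 0 := by
  have key : ((x-y)*(x-z)*(y-z)) • (X*Y-Y*X + (X*Z-Z*X) + (Y*Z-Z*Y)) =
    (y-z) • ((x • a' + y • a)*(x • b' + z • b) - (x • b' + z • b)*(x • a' + y • a)) +
    (x-z) • ((x • a' + y • a)*(y • c' + z • c) - (y • c' + z • c)*(x • a' + y • a)) +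
    (x-y) • ((x • b' + z • b)*(y • c' + z • c) - (y • c' + z • c)*(x • b' + z • b)) := by
    subst hX hY hZ
    generalize (x • a' + y • a) = U
    generalize (x • b' + z • b) = V
    generalize (y • c' + z • c) = W
    simp only [smul_mul_assoc, mul_smul_comm]
    match_scalars <;> field_simp
  have hne : ((x-y)*(x-z)*(y-z)) ≠ 0 := by simp [*]
  refine (smul_eq_zero_iff_right hne).1 (key.trans ?_)
  simp only [smul_mul_assoc, mul_smul_comm, mul_add, add_mul]
  linear_combination (norm := module) (x*y*z - x^2*y) • h321 + (x*y*z - x^2*z) • h231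
    + (x*y*z - x*y^2) • h312 + (x*y*z - x*z^2) • h213 + (x*y*z - y^2*z) • h132
    + (x*y*z - y*z^2) • h123

lemma single_eq (n : ℕ) (j : Fin n) (a : A) :
    single n j a = singleAlgHom (R := ℂ) (A := fun _ : Fin n => A) j a := rfl

lemma single_comm (n : ℕ) {i j : Fin n} (h : i ≠ j) (a b : A) :
    Commute (single n i a) (single n j b) := by
  unfold single
  refine Commute.tprod ?_
  exact Pi.mulSingle_commute (f := fun _ : Fin n => A) h a b

lemma leg2_tmul (n : ℕ) (j k : Fin n) (a b : A) :
    leg2 n j k (a ⊗ₜ[ℂ] b) = single n j a * single n k b := rfl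

lemma leg2_flip (n : ℕ) {j k : Fin n} (h : j ≠ k) (x : A ⊗[ℂ] A) :
    leg2 n j k (flip2 x) = leg2 n k j x := by
  unfold flip2
  induction x with
  | zero => simp
  | add x y hx hy => simp [hx, hy]
  | tmul a b =>
    rw [TensorProduct.comm_tmul, leg2_tmul, leg2_tmul]
    exact single_comm n h b a

lemma leg2_comm_single (n : ℕ) {j k l : Fin n} (h : j ≠ l) (h' : k ≠ l) (x : A ⊗[ℂ] A) (a : A) :
    Commute (leg2 n j k x) (single n l a) := by
  induction x with
  | zero => simp
  | add x y hx hy => simpa using hx.add_left hy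
  | tmul b c =>
    rw [leg2_tmul]
    exact (single_comm n h b a).mul_left (single_comm n h' c a)

lemma leg2_comm_leg2 (n : ℕ) {j k l m : Fin n} (h : j ≠ l) (h' : k ≠ l) (h2 : j ≠ m) (h2' : k ≠ m)
    (x y : A ⊗[ℂ] A) : Commute (leg2 n j k x) (leg2 n l m y) := by
  induction y with
  | zero => simp
  | add x y hx hy => simpa using hx.add_right hy
  | tmul b c =>
    rw [leg2_tmul]
    exact (leg2_comm_single n h h' x b).mul_right (leg2_comm_single n h2 h2' x c)

lemma leg2_mul (n : ℕ) {j k : Fin n} (h : j ≠ k) (x y : A ⊗[ℂ] A) :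
    leg2 n j k (x * y) = leg2 n j k x * leg2 n j k y := by
  induction x with
  | zero => simp
  | add x x' hx hx' => simp [add_mul, hx, hx']
  | tmul a b =>
    induction y with
    | zero => simp
    | add x x' hx hx' => simp [mul_add, hx, hx']
    | tmul c d =>
      simp only [Algebra.TensorProduct.tmul_mul_tmul, leg2_tmul]
      simp only [single_eq, map_mul]
      simp only [← single_eq]
      exact Commute.mul_mul_mul_comm (single_comm n h c b) _ _

lemma leg2_s (n : ℕ) {j k : Fin n} (h : j ≠ k) (r : A ⊗[ℂ] A) (s : A)
    (hs : (s ⊗ₜ[ℂ] (1 : A) + (1 : A) ⊗ₜ[ℂ] s) * r - r * (s ⊗ₜ[ℂ] (1 : A) + (1 : A) ⊗ₜ[ℂ] s)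
            = 0) :
    Commute (leg2 n j k r) (single n j s + single n k s) := by
  have h1 := congrArg (leg2 n j k) hs
  have e : leg2 n j k (s ⊗ₜ[ℂ] (1 : A) + (1 : A) ⊗ₜ[ℂ] s) = single n j s + single n k s := by
    rw [map_add, leg2_tmul, leg2_tmul]
    simp only [single_eq, map_one, mul_one, one_mul]
  rw [map_sub, leg2_mul n h, leg2_mul n h, map_zero, e] at h1
  exact (sub_eq_zero.1 h1).symm

lemma cybe_leg (r : A ⊗[ℂ] A) (hr : CYBE r) (n : ℕ) {a b c : Fin n}
    (hab : a ≠ b) (hac : a ≠ c) (hbc : b ≠ c) :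
    (leg2 n a b r * leg2 n a c r - leg2 n a c r * leg2 n a b r) +
    (leg2 n a b r * leg2 n b c r - leg2 n b c r * leg2 n a b r) +
    (leg2 n a c r * leg2 n b c r - leg2 n b c r * leg2 n a c r) = 0 := by
  let σ : Fin 3 → Fin n := ![a, b, c]
  let f : MultilinearMap ℂ (fun _ : Fin 3 => A) (⨂[ℂ] _ : Fin n, A) :=
    (MultilinearMap.mkPiAlgebraFin ℂ 3 (⨂[ℂ] _ : Fin n, A)).compLinearMap
      (fun i => (singleAlgHom (R := ℂ) (A := fun _ : Fin n => A) (σ i)).toLinearMap)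
  have hf : ∀ x, f x = single n a (x 0) * (single n b (x 1) * single n c (x 2)) := by
    intro x
    simp [f, σ, single_eq, List.ofFn_succ]
  have hone : ∀ i : Fin n, single n i (1 : A) = 1 := fun i => by rw [single_eq, map_one]
  have hmul : ∀ (i : Fin n) (x y : A), single n i (x * y) = single n i x * single n i y :=
    fun i x y => by simp only [single_eq, map_mul]
  have f1 : f 1 = 1 := by
    rw [hf]; simp only [Pi.one_apply, hone, mul_one]
  have fm : ∀ x y, f (x * y) = f x * f y := by
    intro x y
    rw [hf, hf, hf, Pi.mul_apply, Pi.mul_apply, Pi.mul_apply, hmul, hmul, hmul,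
      Commute.mul_mul_mul_comm (single_comm n hbc (y 1) (x 2)),
      Commute.mul_mul_mul_comm ((single_comm n hab (y 0) (x 1)).mul_right
        (single_comm n hac (y 0) (x 2)))]
  obtain ⟨φ, hφ0⟩ : ∃ φ : (⨂[ℂ] _ : Fin 3, A) →ₐ[ℂ] (⨂[ℂ] _ : Fin n, A),
      ∀ x, φ (tprod ℂ x) = f x :=
    ⟨liftAlgHom f f1 fm, fun x => by rw [liftAlgHom_apply, lift.tprod]⟩
  have hφ : ∀ (i : Fin 3) (x : A), φ (single 3 i x) = single n (σ i) x := by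
    intro i x
    have : φ (single 3 i x) = f (Function.update (fun _ => 1) i x) := hφ0 _
    rw [this, hf]
    fin_cases i <;> simp [σ, hone, Function.update]
  have hl : ∀ (i j : Fin 3) (x : A ⊗[ℂ] A), φ (leg2 3 i j x) = leg2 n (σ i) (σ j) x := by
    intro i j x
    induction x with
    | zero => simp
    | add x y hx hy => simp only [map_add, hx, hy]
    | tmul b c => rw [leg2_tmul, leg2_tmul, map_mul, hφ, hφ]
  have := congrArg φ hr
  simp only [map_add, map_sub, map_mul, hl, map_zero] at this
  exact this

lemma leg2_trig (n : ℕ) (r : A ⊗[ℂ] A) (u : Fin n → ℂ) {k j : Fin n} (h : k ≠ j) :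
    leg2 n k j (trigR r (u k - u j)) =
      (Complex.exp (u k) - Complex.exp (u j))⁻¹ •
        (Complex.exp (u k) • leg2 n j k r + Complex.exp (u j) • leg2 n k j r) := by
  have hj := Complex.exp_ne_zero (u j)
  unfold trigR
  simp only [map_smul, map_add, leg2_flip n h, Complex.exp_sub]
  have e : Complex.exp (u k) / Complex.exp (u j) - 1 =
      (Complex.exp (u k) - Complex.exp (u j)) / Complex.exp (u j) := by field_simp
  rw [e, inv_div, div_eq_mul_inv]
  match_scalars <;> field_simp

/-- Commutativity of the trigonometric KZ Hamiltonians. -/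
theorem trigKZH_commute (r : A ⊗[ℂ] A) (s : A) (hr : CYBE r)
    (hs : (s ⊗ₜ[ℂ] (1 : A) + (1 : A) ⊗ₜ[ℂ] s) * r - r * (s ⊗ₜ[ℂ] (1 : A) + (1 : A) ⊗ₜ[ℂ] s)
            = 0)
    (n : ℕ) (hn : 1 ≤ n) (u : Fin n → ℂ)
    (hu : ∀ k j : Fin n, k ≠ j → Complex.exp (u k - u j) ≠ 1)
    (k j : Fin n) (hkj : k ≠ j) :
    trigKZH n r s k u * trigKZH n r s j u - trigKZH n r s j u * trigKZH n r s k u = 0 := by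
  classical
  have hne : ∀ a b : Fin n, a ≠ b → Complex.exp (u a) - Complex.exp (u b) ≠ 0 := by
    intro a b hab h0
    apply hu a b hab
    rw [Complex.exp_sub, sub_eq_zero.1 h0, div_self (Complex.exp_ne_zero _)]
  set G : Fin n → Fin n → ⨂[ℂ] _ : Fin n, A :=
    fun a b => leg2 n a b (trigR r (u a - u b)) with hG
  have hanti : G j k = - G k j := by
    simp only [hG]
    rw [leg2_trig n r u hkj, leg2_trig n r u hkj.symm, ← neg_sub (Complex.exp (u k)), inv_neg]
    module
  set T := (Finset.univ.erase k).erase j with hT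
  have hTk : ∀ c ∈ T, k ≠ c := fun c hc => by
    simp only [hT, Finset.mem_erase] at hc; exact fun h => hc.2.1 h.symm
  have hTj : ∀ c ∈ T, j ≠ c := fun c hc => by
    simp only [hT, Finset.mem_erase] at hc; exact fun h => hc.1 h.symm
  set S : Fin n → ⨂[ℂ] _ : Fin n, A := fun a => ∑ c ∈ T, G a c with hS
  have hHk : trigKZH n r s k u = S k + G k j + single n k s := by
    unfold trigKZH
    rw [← Finset.sum_erase_add (Finset.univ.erase k) _ (Finset.mem_erase.2 ⟨hkj.symm, Finset.mem_univ j⟩)]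
  have hHj : trigKZH n r s j u = S j - G k j + single n j s := by
    unfold trigKZH
    rw [← Finset.sum_erase_add (Finset.univ.erase j) _ (Finset.mem_erase.2 ⟨hkj, Finset.mem_univ k⟩),
      Finset.erase_right_comm, sub_eq_add_neg (S j), ← hanti]
  have h1 : Commute (S k) (single n j s) := Finset.sum_induction _ (fun x => Commute x (single n j s))
    (fun _ _ => Commute.add_left) (Commute.zero_left _)
    fun c hc => leg2_comm_single n hkj (hTj c hc).symm _ _
  have h2 : Commute (S j) (single n k s) := Finset.sum_induction _ (fun x => Commute x (single n k s))
    (fun _ _ => Commute.add_left) (Commute.zero_left _)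
    fun c hc => leg2_comm_single n hkj.symm (hTk c hc).symm _ _
  have h3 : Commute (single n k s) (single n j s) := single_comm n hkj s s
  have h4 : Commute (G k j) (single n k s + single n j s) := by
    simp only [hG]
    rw [leg2_trig n r u hkj]
    refine Commute.smul_left (Commute.add_left (Commute.smul_left ?_ _) (Commute.smul_left ?_ _)) _
    · rw [add_comm]; exact leg2_s n hkj.symm r s hs
    · exact leg2_s n hkj r s hs
  have h5 : S k * S j - S j * S k = ∑ c ∈ T, (G k c * G j c - G j c * G k c) := by
    simp only [hS]
    rw [Finset.sum_mul_sum, Finset.sum_mul_sum, Finset.sum_comm, ← Finset.sum_sub_distrib]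
    refine Finset.sum_congr rfl fun c hc => ?_
    rw [← Finset.sum_sub_distrib]
    refine Finset.sum_eq_single_of_mem c hc fun d hd hdc => ?_
    exact sub_eq_zero.2 (leg2_comm_leg2 n hkj (hTj d hd).symm (hTk c hc) hdc _ _)
  have h6 : (G k j * S k - S k * G k j) + (G k j * S j - S j * G k j) +
      (S k * S j - S j * S k) = 0 := by
    rw [h5]
    simp only [hS]
    rw [Finset.mul_sum, Finset.mul_sum, Finset.sum_mul, Finset.sum_mul, ← Finset.sum_sub_distrib,
      ← Finset.sum_sub_distrib, ← Finset.sum_add_distrib, ← Finset.sum_add_distrib]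
    refine Finset.sum_eq_zero fun c hc => ?_
    have hkc := hTk c hc
    have hjc := hTj c hc
    exact aux_alg _ _ _ _ _ _ _ _ _ (hne k j hkj) (hne k c hkc) (hne j c hjc)
      (cybe_leg r hr n hkj hkc hjc) (cybe_leg r hr n hkc hkj hjc.symm)
      (cybe_leg r hr n hkj.symm hjc hkc) (cybe_leg r hr n hjc hkj.symm hkc.symm)
      (cybe_leg r hr n hkc.symm hjc.symm hkj) (cybe_leg r hr n hjc.symm hkc.symm hkj.symm)
      _ _ _ (leg2_trig n r u hkj) (leg2_trig n r u hkc) (leg2_trig n r u hjc)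
  rw [hHk, hHj]
  have e1 := sub_eq_zero.2 h1.eq
  have e2 := sub_eq_zero.2 h2.eq
  have e3 := sub_eq_zero.2 h3.eq
  have e4 := sub_eq_zero.2 h4.eq
  simp only [mul_add, add_mul, mul_sub, sub_mul] at e4 ⊢
  linear_combination (norm := module) (1 : ℤ) • h6 + (1 : ℤ) • e1 - (1 : ℤ) • e2 + (1 : ℤ) • e3 + (1 : ℤ) • e4

end
end

section
/- If r = Σᵢ aᵢ⊗bᵢ ∈ A⊗A satisfies the classical Yang–Baxter equation and ρ_r := Σᵢ aᵢbᵢ ∈ A denotes the image of r under the multiplication map, then [ρ_r⊗1 + 1⊗ρ_r, r] = 0 in A⊗A. (Consequently, for any s ∈ A with [s⊗1 + 1⊗s, r] = 0, the element t := s + ρ_r also satisfies [t⊗1 + 1⊗t, r] = 0.) -/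
/-!
STATEMENT 6: If `r = Σᵢ aᵢ⊗bᵢ ∈ A ⊗ A` satisfies the classical Yang–Baxter equation and
`ρ_r = Σᵢ aᵢbᵢ ∈ A` denotes the image of `r` under the multiplication map, then
`[ρ_r⊗1 + 1⊗ρ_r, r] = 0` in `A ⊗ A`. Consequently, for any `s ∈ A` with
`[s⊗1 + 1⊗s, r] = 0`, the element `t = s + ρ_r` also satisfies `[t⊗1 + 1⊗t, r] = 0`.
-/

open scoped TensorProduct
open PiTensorProduct

noncomputable section

variable {A : Type*} [Ring A] [Algebra ℂ A]

/-- `ρ_r = Σᵢ aᵢbᵢ`, the image of `r = Σᵢ aᵢ⊗bᵢ` under the multiplication map `A ⊗ A → A`. -/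
def rho (r : A ⊗[ℂ] A) : A := LinearMap.mul' ℂ A r

/-- `x ⊗ y ⊗ z ↦ xy ⊗ z`. -/
def mulLeft3 : (⨂[ℂ] _ : Fin 3, A) →ₗ[ℂ] A ⊗[ℂ] A :=
  PiTensorProduct.lift
    { toFun := fun v => (v 0 * v 1) ⊗ₜ[ℂ] v 2
      map_update_add' := by
        intro inst m i x y
        obtain rfl : inst = instDecidableEqFin 3 := Subsingleton.elim _ _
        fin_cases i <;> simp [add_mul, mul_add, TensorProduct.add_tmul, TensorProduct.tmul_add]
      map_update_smul' := by
        intro inst m i c x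
        obtain rfl : inst = instDecidableEqFin 3 := Subsingleton.elim _ _
        fin_cases i <;> simp [TensorProduct.smul_tmul'] }

/-- `x ⊗ y ⊗ z ↦ x ⊗ yz`. -/
def mulRight3 : (⨂[ℂ] _ : Fin 3, A) →ₗ[ℂ] A ⊗[ℂ] A :=
  PiTensorProduct.lift
    { toFun := fun v => v 0 ⊗ₜ[ℂ] (v 1 * v 2)
      map_update_add' := by
        intro inst m i x y
        obtain rfl : inst = instDecidableEqFin 3 := Subsingleton.elim _ _
        fin_cases i <;> simp [add_mul, mul_add, TensorProduct.add_tmul, TensorProduct.tmul_add]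
      map_update_smul' := by
        intro inst m i c x
        obtain rfl : inst = instDecidableEqFin 3 := Subsingleton.elim _ _
        fin_cases i <;> simp [TensorProduct.smul_tmul'] }

lemma mulLeft3_tprod (v : Fin 3 → A) :
    mulLeft3 (tprod ℂ v) = (v 0 * v 1) ⊗ₜ[ℂ] v 2 := by
  simp [mulLeft3]

lemma mulRight3_tprod (v : Fin 3 → A) :
    mulRight3 (tprod ℂ v) = v 0 ⊗ₜ[ℂ] (v 1 * v 2) := by
  simp [mulRight3]

lemma leg2_sum (j k : Fin 3) (S : Finset (A × A)) :
    leg2 3 j k (∑ i ∈ S, i.1 ⊗ₜ[ℂ] i.2) = ∑ i ∈ S, single 3 j i.1 * single 3 k i.2 := by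
  simp [leg2]

lemma rho_main (r : A ⊗[ℂ] A) (hr : CYBE r) :
    (rho r ⊗ₜ[ℂ] (1 : A) + (1 : A) ⊗ₜ[ℂ] rho r) * r -
        r * (rho r ⊗ₜ[ℂ] (1 : A) + (1 : A) ⊗ₜ[ℂ] rho r) = 0 := by
  obtain ⟨S, rfl⟩ := TensorProduct.exists_finset r
  unfold CYBE at hr
  simp only [leg2_sum] at hr
  have h1 := congrArg mulLeft3 hr
  have h2 := congrArg mulRight3 hr
  have e : ∑ i ∈ S, ∑ j ∈ S, (j.1 * i.1) ⊗ₜ[ℂ] (i.2 * j.2) =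
      ∑ i ∈ S, ∑ j ∈ S, (i.1 * j.1) ⊗ₜ[ℂ] (j.2 * i.2) := Finset.sum_comm
  have e1 : ∑ i ∈ S, ∑ j ∈ S, (j.1 * (i.1 * j.2)) ⊗ₜ[ℂ] i.2 =
      ∑ i ∈ S, ∑ j ∈ S, (i.1 * (j.1 * i.2)) ⊗ₜ[ℂ] j.2 := Finset.sum_comm
  have e2 : ∑ i ∈ S, ∑ j ∈ S, j.1 ⊗ₜ[ℂ] (i.1 * (j.2 * i.2)) =
      ∑ i ∈ S, ∑ j ∈ S, i.1 ⊗ₜ[ℂ] (j.1 * (i.2 * j.2)) := Finset.sum_comm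
  simp only [Finset.sum_mul_sum, map_add, map_sub, map_sum, map_zero, single,
    tprod_mul_tprod, mulLeft3_tprod, mulRight3_tprod, Pi.mul_apply] at h1 h2
  simp [mul_assoc] at h1 h2
  simp only [rho, map_sum, LinearMap.mul'_apply, TensorProduct.sum_tmul, TensorProduct.tmul_sum,
    add_mul, mul_add, Finset.sum_mul_sum, Algebra.TensorProduct.tmul_mul_tmul, one_mul, mul_one,
    mul_assoc]
  rw [e, e1] at h1
  rw [e2] at h2
  rw [← sub_eq_zero.mpr (h1.trans h2.symm)]
  abel

theorem rho_commutes_with_r (r : A ⊗[ℂ] A) (hr : CYBE r) :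
    ((rho r ⊗ₜ[ℂ] (1 : A) + (1 : A) ⊗ₜ[ℂ] rho r) * r -
        r * (rho r ⊗ₜ[ℂ] (1 : A) + (1 : A) ⊗ₜ[ℂ] rho r) = 0) ∧
    (∀ s : A,
      (s ⊗ₜ[ℂ] (1 : A) + (1 : A) ⊗ₜ[ℂ] s) * r - r * (s ⊗ₜ[ℂ] (1 : A) + (1 : A) ⊗ₜ[ℂ] s) = 0 →
      ((s + rho r) ⊗ₜ[ℂ] (1 : A) + (1 : A) ⊗ₜ[ℂ] (s + rho r)) * r -
        r * ((s + rho r) ⊗ₜ[ℂ] (1 : A) + (1 : A) ⊗ₜ[ℂ] (s + rho r)) = 0) := by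
  refine ⟨rho_main r hr, fun s hs => ?_⟩
  have h := rho_main r hr
  rw [TensorProduct.add_tmul, TensorProduct.tmul_add]
  have := congrArg₂ (· + ·) hs h
  simp only [add_zero] at this
  rw [← this]
  noncomm_ring

end
end
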